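/- The s-tuples (P_1,...,P_s) of points of P^{n_1} × ⋯ × P^{n_k}, regarded as points of (P^{n_1} × ⋯ × P^{n_k})^s, whose underlying point set is in generic position form a non-empty Zariski-open subset of (P^{n_1} × ⋯ × P^{n_k})^s. -/

import Mathlib

open MvPolynomial

namespace MultiProjPoints

/-- The variable set of the multigraded coordinate ring of
`ℙ^{n 0} × ⋯ × ℙ^{n (k-1)}`: variables `x_{i,j}` with `i : Fin k`, `0 ≤ j ≤ n i`. -/
abbrev Var (k : ℕ) (n : Fin k → ℕ) := Σ i : Fin k, Fin (n i + 1)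

/-- The `ℕ^k`-grading weight: `deg x_{i,j} = e_i`. -/
def wt (k : ℕ) (n : Fin k → ℕ) : Var k n → (Fin k → ℕ) := fun v => Pi.single v.1 1

/-- The `i`-th standard basis vector of `ℕ^k`. -/
def e {k : ℕ} (l : Fin k) : Fin k → ℕ := Pi.single l 1

variable (K : Type) [Field K]

/-- The graded piece `R_d` of the `ℕ^k`-graded polynomial ring. -/
noncomputable def piece (k : ℕ) (n : Fin k → ℕ) (d : Fin k → ℕ) :
    Submodule K (MvPolynomial (Var k n) K) :=
  weightedHomogeneousSubmodule K (wt k n) d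

/-- `N(d) = ∏ binom (n i + d i) (d i)`, the dimension of `R_d`. -/
def NN (k : ℕ) (n : Fin k → ℕ) (d : Fin k → ℕ) : ℕ := ∏ i, (n i + d i).choose (d i)

/-- A (representative of a) point of `ℙ^{n 0} × ⋯ × ℙ^{n (k-1)}`. -/
def PointRep (k : ℕ) (n : Fin k → ℕ) := (i : Fin k) → Fin (n i + 1) → K

/-- A valid representative: every coordinate block is nonzero. -/
def IsRep {k : ℕ} {n : Fin k → ℕ} (P : PointRep K k n) : Prop := ∀ i, P i ≠ 0

/-- Two representatives define the same point of multi-projective space. -/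
def ProjEq {k : ℕ} {n : Fin k → ℕ} (P Q : PointRep K k n) : Prop :=
  ∀ i, ∃ c : K, c ≠ 0 ∧ P i = c • Q i

/-- A tuple of representatives giving `s` distinct points. -/
def SPoints {k : ℕ} {n : Fin k → ℕ} {s : ℕ} (P : Fin s → PointRep K k n) : Prop :=
  (∀ a, IsRep K (P a)) ∧ ∀ a b, a ≠ b → ¬ ProjEq K (P a) (P b)

/-- The defining ideal `I_X` of the set of points: all polynomials vanishing on
the multi-cone over the points, i.e. the intersection of the point ideals. -/
noncomputable def idealOfPoints {k : ℕ} {n : Fin k → ℕ} {s : ℕ}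
    (P : Fin s → PointRep K k n) : Ideal (MvPolynomial (Var k n) K) :=
  ⨅ (a : Fin s), ⨅ (c : Fin k → K),
    RingHom.ker (eval (fun v : Var k n => c v.1 * P a v.1 v.2))

/-- The degree-`d` piece `I_d` of an ideal, as a `K`-subspace. -/
noncomputable def idealPiece {k : ℕ} {n : Fin k → ℕ}
    (I : Ideal (MvPolynomial (Var k n) K)) (d : Fin k → ℕ) :
    Submodule K (MvPolynomial (Var k n) K) :=
  (Submodule.restrictScalars K I) ⊓ piece K k n d

/-- The multigraded Hilbert function of `X`:
`H_X(d) = dim (R/I_X)_d = dim R_d - dim (I_X)_d`. -/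
noncomputable def hilbert {k : ℕ} {n : Fin k → ℕ} {s : ℕ}
    (P : Fin s → PointRep K k n) (d : Fin k → ℕ) : ℕ :=
  NN k n d - Module.finrank K (idealPiece K (idealOfPoints K P) d)

/-- Generic position: `s` distinct points whose Hilbert function is maximal. -/
def GenericPosition {k : ℕ} {n : Fin k → ℕ} {s : ℕ} (P : Fin s → PointRep K k n) : Prop :=
  SPoints K P ∧ ∀ d : Fin k → ℕ, hilbert K P d = min (NN k n d) s

/-- `R_{e_l}·V`: the span of all products of a variable of degree `e_l`
with an element of `V`. -/
noncomputable def mulSpan {k : ℕ} {n : Fin k → ℕ} (l : Fin k)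
    (V : Submodule K (MvPolynomial (Var k n) K)) :
    Submodule K (MvPolynomial (Var k n) K) :=
  Submodule.span K {g | ∃ (m : Fin (n l + 1)) (f : MvPolynomial (Var k n) K),
    f ∈ V ∧ g = X (⟨l, m⟩ : Var k n) * f}

/-- `D = min { i ∈ ℕ^k | N(i) > s }` (minimal elements for the componentwise order). -/
def Dset (k : ℕ) (n : Fin k → ℕ) (s : ℕ) : Set (Fin k → ℕ) :=
  {i | s < NN k n i ∧ ∀ j : Fin k → ℕ, s < NN k n j → j ≤ i → j = i}

/-- The irrelevant maximal ideal of `R`, generated by all the variables. -/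
noncomputable def irrelevant (k : ℕ) (n : Fin k → ℕ) : Ideal (MvPolynomial (Var k n) K) :=
  Ideal.span (Set.range (X : Var k n → MvPolynomial (Var k n) K))

/-! ### Helper material -/

/-- Exponent vectors of monomials of multidegree `d`. -/
abbrev Mon (k : ℕ) (n : Fin k → ℕ) (d : Fin k → ℕ) :=
  {α : Var k n → ℕ // ∀ i, ∑ j, α ⟨i, j⟩ = d i}

noncomputable def monEquiv (k : ℕ) (n : Fin k → ℕ) (d : Fin k → ℕ) :
    Mon k n d ≃ ((i : Fin k) → Sym (Fin (n i + 1)) (d i)) :=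
  ((Equiv.piCurry (fun (i : Fin k) (_ : Fin (n i + 1)) => ℕ)).subtypeEquiv
    (q := fun β => ∀ i, ∑ j, β i j = d i) (fun _ => Iff.rfl)).trans
  ((Equiv.subtypePiEquivPi (p := fun i (β : Fin (n i + 1) → ℕ) => ∑ j, β j = d i)).trans
    (Equiv.piCongrRight fun i => (Sym.equivNatSumOfFintype (Fin (n i + 1)) (d i)).symm))

noncomputable instance monFintype (k : ℕ) (n : Fin k → ℕ) (d : Fin k → ℕ) :
    Fintype (Mon k n d) := Fintype.ofEquiv _ (monEquiv k n d).symm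

theorem card_mon (k : ℕ) (n : Fin k → ℕ) (d : Fin k → ℕ) :
    Fintype.card (Mon k n d) = NN k n d := by
  rw [Fintype.card_congr (monEquiv k n d), Fintype.card_pi, NN]
  refine Finset.prod_congr rfl fun i _ => ?_
  rw [Sym.card_sym_eq_choose, Fintype.card_fin]
  congr 1
  omega

theorem weight_wt {k : ℕ} {n : Fin k → ℕ} (α : Var k n →₀ ℕ) (i : Fin k) :
    Finsupp.weight (wt k n) α i = ∑ j, α ⟨i, j⟩ := by
  rw [Finsupp.weight_apply, Finsupp.sum_fintype _ _ (by simp), Finset.sum_apply,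
    Fintype.sum_sigma]
  rw [Finset.sum_eq_single i]
  · simp [wt]
  · intro b _ hb
    simp [wt, hb.symm]
  · simp

/-- The evaluation matrix. -/
def evMat {R : Type} [CommRing R] {k : ℕ} {n : Fin k → ℕ} {s : ℕ}
    (x : Fin s → Var k n → R) (d : Fin k → ℕ) : Matrix (Fin s) (Mon k n d) R :=
  Matrix.of fun a α => ∏ v, x a v ^ α.1 v

/-- The coordinates of a tuple. -/
def coords {k : ℕ} {n : Fin k → ℕ} {s : ℕ} (P : Fin s → PointRep K k n) :
    Fin s → Var k n → K := fun a v => P a v.1 v.2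

/-- polynomial with given coefficients -/
noncomputable def polyOf (k : ℕ) (n : Fin k → ℕ) (d : Fin k → ℕ) :
    (Mon k n d → K) →ₗ[K] MvPolynomial (Var k n) K :=
  ∑ α : Mon k n d, (monomial (Finsupp.equivFunOnFinite.symm α.1)).comp (LinearMap.proj α)

theorem polyOf_apply {k : ℕ} {n : Fin k → ℕ} {d : Fin k → ℕ} (c : Mon k n d → K) :
    polyOf K k n d c = ∑ α, monomial (Finsupp.equivFunOnFinite.symm α.1) (c α) := by
  simp [polyOf]

theorem coeff_polyOf {k : ℕ} {n : Fin k → ℕ} {d : Fin k → ℕ} (c : Mon k n d → K)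
    (α : Mon k n d) :
    coeff (Finsupp.equivFunOnFinite.symm α.1) (polyOf K k n d c) = c α := by
  classical
  rw [polyOf_apply, coeff_sum, Finset.sum_eq_single α]
  · simp
  · intro b _ hb
    rw [coeff_monomial, if_neg]
    intro h
    exact hb (Subtype.ext (Finsupp.equivFunOnFinite.symm.injective h))
  · simp

theorem polyOf_injective (k : ℕ) (n : Fin k → ℕ) (d : Fin k → ℕ) :
    Function.Injective (polyOf K k n d) := by
  intro c c' h
  funext α
  rw [← coeff_polyOf K c α, h, coeff_polyOf]

theorem range_polyOf (k : ℕ) (n : Fin k → ℕ) (d : Fin k → ℕ) :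
    LinearMap.range (polyOf K k n d) = piece K k n d := by
  classical
  apply le_antisymm
  · rintro _ ⟨c, rfl⟩
    rw [polyOf_apply]
    refine Submodule.sum_mem _ fun α _ => ?_
    refine isWeightedHomogeneous_monomial _ _ _ ?_
    funext i
    rw [weight_wt]
    exact α.2 i
  · intro f hf
    refine ⟨fun α => coeff (Finsupp.equivFunOnFinite.symm α.1) f, ?_⟩
    ext β
    by_cases hβ : ∀ i, ∑ j, β ⟨i, j⟩ = d i
    · have := coeff_polyOf K (fun α : Mon k n d => coeff (Finsupp.equivFunOnFinite.symm α.1) f)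
        ⟨β, hβ⟩
      simpa using this
    · have h0 : coeff β f = 0 := by
        by_contra h
        apply hβ
        intro i
        rw [← weight_wt, hf h]
      rw [h0, polyOf_apply, coeff_sum]
      refine Finset.sum_eq_zero fun α _ => ?_
      rw [coeff_monomial, if_neg]
      rintro rfl
      exact hβ α.2

theorem eval_polyOf {k : ℕ} {n : Fin k → ℕ} {d : Fin k → ℕ} (c : Mon k n d → K)
    (t : Fin k → K) (x : Var k n → K) :
    eval (fun v : Var k n => t v.1 * x v) (polyOf K k n d c) =
      (∏ i, t i ^ d i) * ∑ α, (∏ v, x v ^ α.1 v) * c α := by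
  rw [polyOf_apply, map_sum, Finset.mul_sum]
  refine Finset.sum_congr rfl fun α _ => ?_
  rw [eval_monomial, Finsupp.prod_fintype _ _ (by simp)]
  simp only [Finsupp.equivFunOnFinite_symm_apply_apply, mul_pow, Finset.prod_mul_distrib]
  have : ∏ v : Var k n, t v.1 ^ α.1 v = ∏ i, t i ^ d i := by
    rw [Fintype.prod_sigma]
    refine Finset.prod_congr rfl fun i _ => ?_
    rw [← α.2 i]
    exact Finset.prod_pow_eq_pow_sum Finset.univ (fun j => α.1 ⟨i, j⟩) (t i)
  rw [this]
  ring

theorem idealPiece_eq {k : ℕ} {n : Fin k → ℕ} {s : ℕ} (P : Fin s → PointRep K k n)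
    (d : Fin k → ℕ) :
    idealPiece K (idealOfPoints K P) d =
      (LinearMap.ker (evMat (coords K P) d).mulVecLin).map (polyOf K k n d) := by
  rw [idealPiece, ← range_polyOf]
  ext f
  simp only [Submodule.mem_inf, Submodule.restrictScalars_mem, idealOfPoints, Submodule.mem_iInf,
    RingHom.mem_ker, Submodule.mem_map, LinearMap.mem_ker, LinearMap.mem_range]
  constructor
  · rintro ⟨h, c, rfl⟩
    refine ⟨c, ?_, rfl⟩
    funext a
    have := h a 1
    have h2 := eval_polyOf K c 1 (coords K P a)
    simp only [coords] at h2
    rw [this] at h2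
    simpa [Matrix.mulVec, dotProduct, evMat, coords] using h2.symm
  · rintro ⟨c, hc, rfl⟩
    refine ⟨fun a t => ?_, c, rfl⟩
    have h2 := eval_polyOf K c t (coords K P a)
    have h3 := congrFun hc a
    simp only [coords] at h2
    rw [h2]
    simp only [Matrix.mulVecLin_apply, Matrix.mulVec, dotProduct, evMat, coords, Matrix.of_apply,
      Pi.zero_apply] at h3
    rw [h3, mul_zero]

theorem hilbert_eq_rank {k : ℕ} {n : Fin k → ℕ} {s : ℕ} (P : Fin s → PointRep K k n)
    (d : Fin k → ℕ) : hilbert K P d = (evMat (coords K P) d).rank := by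
  have h1 := LinearMap.finrank_range_add_finrank_ker (evMat (coords K P) d).mulVecLin
  rw [Module.finrank_fintype_fun_eq_card, card_mon] at h1
  rw [hilbert, idealPiece_eq, ← (Submodule.equivMapOfInjective _ (polyOf_injective K k n d) _).finrank_eq,
    Matrix.rank]
  omega

/-- monotonicity of surjectivity -/
theorem rank_mono {k : ℕ} {n : Fin k → ℕ} {s : ℕ} (P : Fin s → PointRep K k n)
    (hP : ∀ a, IsRep K (P a)) {d d' : Fin k → ℕ} (hd : d ≤ d')
    (h : (evMat (coords K P) d).rank = s) : (evMat (coords K P) d').rank = s := by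
  have hli : LinearIndependent K (evMat (coords K P) d).row := by
    rw [linearIndependent_iff_card_eq_finrank_span, Set.finrank, ← Matrix.rank_eq_finrank_span_row, h,
      Fintype.card_fin]
  have hli' : LinearIndependent K (evMat (coords K P) d').row := by
    rw [Fintype.linearIndependent_iff] at hli ⊢
    intro g hg b
    have hj : ∀ i, ∃ j, P b i j ≠ 0 := fun i => Function.ne_iff.1 (hP b i)
    choose j hj using hj
    -- exponent of the multiplier
    let γ : Var k n → ℕ := fun v => if v.2 = j v.1 then d' v.1 - d v.1 else 0
    have hγ : ∀ i, ∑ l, γ ⟨i, l⟩ = d' i - d i := by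
      intro i
      simp [γ]
    have key := hli (fun a => g a * ∏ v, coords K P a v ^ γ v) (by
      funext α
      have h1 := congrFun hg ⟨fun v => α.1 v + γ v, fun i => by
        have : d i ≤ d' i := hd i
        rw [Finset.sum_add_distrib, α.2 i, hγ]
        omega⟩
      simp only [Finset.sum_apply, Pi.smul_apply, smul_eq_mul, Matrix.row, evMat, Matrix.of_apply,
        Pi.zero_apply, pow_add, Finset.prod_mul_distrib] at h1 ⊢
      rw [← h1]
      refine Finset.sum_congr rfl fun a _ => ?_
      ring) b
    refine (mul_eq_zero.1 key).resolve_right ?_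
    refine Finset.prod_ne_zero_iff.2 fun v _ => ?_
    by_cases hv : v.2 = j v.1
    · refine pow_ne_zero _ ?_
      simp only [coords, hv]
      exact hj v.1
    · simp [γ, hv]
  rw [hli'.rank_matrix, Fintype.card_fin]

theorem NN_mono {k : ℕ} {n : Fin k → ℕ} {d d' : Fin k → ℕ} (hd : d ≤ d') :
    NN k n d ≤ NN k n d' := by
  refine Finset.prod_le_prod' fun i _ => ?_
  rw [← Nat.choose_symm_add, ← Nat.choose_symm_add, add_comm (n i), add_comm (n i)]
  exact Nat.choose_le_choose _ (Nat.add_le_add_right (hd i) _)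

theorem lt_NN {k : ℕ} {n : Fin k → ℕ} (hn : ∀ i, 1 ≤ n i) (d : Fin k → ℕ) (i : Fin k) :
    d i < NN k n d := by
  have h1 : (n i + d i).choose (d i) ≤ NN k n d :=
    Finset.single_le_prod' (f := fun i => (n i + d i).choose (d i))
      (fun i _ => Nat.choose_pos (Nat.le_add_left _ _)) (Finset.mem_univ i)
  have h2 : (1 + d i).choose (d i) ≤ (n i + d i).choose (d i) :=
    Nat.choose_le_choose _ (Nat.add_le_add_right (hn i) _)
  rw [add_comm 1, Nat.choose_succ_self_right] at h2
  omega

/-- The finitely many degrees to test. -/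
noncomputable def box (k s : ℕ) : Finset (Fin k → ℕ) := Fintype.piFinset fun _ => Finset.range (s + 1)

theorem all_of_box {k : ℕ} {n : Fin k → ℕ} (hn : ∀ i, 1 ≤ n i) {s : ℕ}
    (P : Fin s → PointRep K k n) (hP : ∀ a, IsRep K (P a))
    (h : ∀ d ∈ box k s, (evMat (coords K P) d).rank = min (NN k n d) s) (d : Fin k → ℕ) :
    (evMat (coords K P) d).rank = min (NN k n d) s := by
  by_cases hd : ∀ i, d i ≤ s
  · exact h d (by simp [box, hd])
  · push Not at hd
    obtain ⟨i, hi⟩ := hd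
    have hle : (fun i => min (d i) s) ≤ d := fun i => min_le_left _ _
    have h1 := h (fun i => min (d i) s) (by simp [box])
    have h2 := lt_NN hn (fun i => min (d i) s) i
    simp only [min_eq_right hi.le] at h2
    rw [min_eq_right h2.le] at h1
    rw [rank_mono K P hP hle h1, min_eq_right (h2.le.trans (NN_mono hle))]

theorem exists_det_ne_zero {p q : Type} [Fintype p] [Fintype q] [DecidableEq p] [DecidableEq q]
    (A : Matrix p q K) (r : ℕ) :
    r ≤ A.rank ↔ ∃ (B : Matrix (Fin r) p K) (C : Matrix q (Fin r) K), (B * A * C).det ≠ 0 := by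
  constructor
  · intro h
    obtain ⟨v, hv⟩ := exists_linearIndependent_of_le_finrank (R := K)
      (M := LinearMap.range A.mulVecLin) h
    choose c hc using fun i => (v i).2
    let C : Matrix q (Fin r) K := Matrix.of fun x i => c i x
    have hcol : ∀ i, (A * C).col i = (v i : p → K) := by
      intro i
      rw [← hc i]
      rfl
    have hinj : LinearMap.ker (A * C).mulVecLin = ⊥ := by
      rw [LinearMap.ker_eq_bot, Matrix.coe_mulVecLin, Matrix.mulVec_injective_iff]
      have : (A * C).col = fun i => (v i : p → K) := funext hcol
      rw [this]
      exact hv.map' (Submodule.subtype _) (Submodule.ker_subtype _)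
    obtain ⟨g, hg⟩ := LinearMap.exists_leftInverse_of_injective _ hinj
    refine ⟨LinearMap.toMatrix' g, C, ?_⟩
    have : LinearMap.toMatrix' g * A * C = 1 := by
      rw [Matrix.mul_assoc]
      conv_lhs => rw [← LinearMap.toMatrix'_toLin' (A * C)]
      rw [← LinearMap.toMatrix'_comp, Matrix.toLin'_apply', hg, LinearMap.toMatrix'_id]
    rw [this, Matrix.det_one]
    exact one_ne_zero
  · rintro ⟨B, C, h⟩
    have h1 := Matrix.rank_of_det_ne_zero h
    rw [Fintype.card_fin] at h1
    calc r = (B * A * C).rank := h1.symm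
      _ ≤ (B * A).rank := Matrix.rank_mul_le_left _ _
      _ ≤ A.rank := Matrix.rank_mul_le_right _ _

theorem rank_le {k : ℕ} {n : Fin k → ℕ} {s : ℕ} (x : Fin s → Var k n → K) (d : Fin k → ℕ) :
    (evMat x d).rank ≤ min (NN k n d) s := by
  refine le_min ?_ ?_
  · rw [← card_mon]
    exact Matrix.rank_le_card_width _
  · simpa using Matrix.rank_le_card_height (evMat x d)

/-- The polynomials whose nonvanishing says that the rank in degree `d` is maximal. -/
noncomputable def detPoly {k : ℕ} (n : Fin k → ℕ) (s : ℕ) (d : Fin k → ℕ)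
    (B : Matrix (Fin (min (NN k n d) s)) (Fin s) K)
    (C : Matrix (Mon k n d) (Fin (min (NN k n d) s)) K) : MvPolynomial (Fin s × Var k n) K :=
  Matrix.det (B.map (MvPolynomial.C : K →+* MvPolynomial (Fin s × Var k n) K) *
    evMat (fun a v => (X (a, v) : MvPolynomial (Fin s × Var k n) K)) d *
    C.map (MvPolynomial.C : K →+* MvPolynomial (Fin s × Var k n) K))

theorem eval_detPoly {k : ℕ} (n : Fin k → ℕ) (s : ℕ) (d : Fin k → ℕ)
    (B : Matrix (Fin (min (NN k n d) s)) (Fin s) K)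
    (C : Matrix (Mon k n d) (Fin (min (NN k n d) s)) K) (x : Fin s → Var k n → K) :
    eval (fun p : Fin s × Var k n => x p.1 p.2) (detPoly K n s d B C) =
      (B * evMat x d * C).det := by
  rw [detPoly, RingHom.map_det, RingHom.mapMatrix_apply, Matrix.map_mul, Matrix.map_mul]
  congr 2
  · congr 1
    · ext i j; simp
    · ext i j; simp [evMat]
  · ext i j; simp

theorem exists_generic [CharZero K] (k : ℕ) (hk : 0 < k) (n : Fin k → ℕ) (hn : ∀ i, 1 ≤ n i)
    (s : ℕ) : ∃ P : Fin s → PointRep K k n, GenericPosition K P := by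
  classical
  obtain ⟨eq⟩ : Nonempty (Var k n ≃ Fin (Fintype.card (Var k n))) := ⟨Fintype.equivFin _⟩
  let pr : Var k n → ℕ := fun v => Nat.nth Nat.Prime (eq v)
  have hpr : ∀ v, (pr v).Prime := fun v => Nat.prime_nth_prime _
  have hinj : Function.Injective pr := by
    intro v w h
    exact eq.injective (Fin.ext (Nat.nth_injective Nat.infinite_setOfPred_prime h))
  have hne : ∀ v, (pr v : K) ≠ 0 := fun v => Nat.cast_ne_zero.2 (hpr v).ne_zero
  let P : Fin s → PointRep K k n := fun a i j => (pr ⟨i, j⟩ : K) ^ (a : ℕ)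
  refine ⟨P, ⟨?_, ?_⟩, ?_⟩
  · intro a i h
    have := congrFun h 0
    exact pow_ne_zero _ (hne _) this
  · intro a b hab h
    obtain ⟨c, hc, h⟩ := h ⟨0, hk⟩
    have h0 := congrFun h 0
    have h1 := congrFun h (Fin.last _)
    simp only [P, Pi.smul_apply, smul_eq_mul] at h0 h1
    set p := pr ⟨⟨0, hk⟩, 0⟩ with hp
    set q := pr ⟨⟨0, hk⟩, Fin.last _⟩ with hq
    have hpq : p ≠ q := by
      intro h
      have h := hinj h
      have h : (0 : Fin (n ⟨0, hk⟩ + 1)) = Fin.last _ := by simpa using h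
      have h := congrArg Fin.val h
      have := hn ⟨0, hk⟩
      simp at h
      omega
    have hmul : (p : K) ^ (a : ℕ) * (q : K) ^ (b : ℕ) = (p : K) ^ (b : ℕ) * (q : K) ^ (a : ℕ) := by
      rw [h0, h1]; ring
    have hmul' : p ^ (a : ℕ) * q ^ (b : ℕ) = p ^ (b : ℕ) * q ^ (a : ℕ) := by exact_mod_cast hmul
    have hpp : p.Prime := hpr _
    have hqp : q.Prime := hpr _
    have hf := congrArg (fun m => Nat.factorization m p) hmul'
    simp only [Nat.factorization_mul (pow_ne_zero _ hpp.ne_zero) (pow_ne_zero _ hqp.ne_zero),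
      hpp.factorization_pow, hqp.factorization_pow, Finsupp.add_apply, Finsupp.single_apply,
      if_neg hpq.symm] at hf
    simp at hf
    exact hab (Fin.ext hf)
  · intro d
    rw [hilbert_eq_rank]
    refine le_antisymm (rank_le K _ d) ?_
    let y : Mon k n d → ℕ := fun α => ∏ v, pr v ^ α.1 v
    have hy : Function.Injective y := by
      intro α β h
      apply Subtype.ext
      funext v
      have hf : ∀ γ : Mon k n d, (y γ).factorization (pr v) = γ.1 v := by
        intro γ
        simp only [y]
        rw [Nat.factorization_prod fun w _ => pow_ne_zero _ (hpr w).ne_zero]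
        rw [Finsupp.finsetSum_apply, Finset.sum_eq_single v]
        · simp [(hpr v).factorization_pow]
        · intro w _ hw
          rw [(hpr w).factorization_pow, Finsupp.single_apply, if_neg]
          exact fun h => hw (hinj h)
        · simp
      rw [← hf α, h, hf β]
    set r := min (NN k n d) s with hr
    obtain ⟨em⟩ : Nonempty (Fin r ↪ Mon k n d) := by
      apply Function.Embedding.nonempty_of_card_le
      rw [card_mon, Fintype.card_fin]
      exact min_le_left _ _
    let ca : Fin r → Fin s := Fin.castLE (min_le_right _ _)
    have hsub : (evMat (coords K P) d).submatrix ca em =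
        (Matrix.vandermonde (fun i => (y (em i) : K))).transpose := by
      ext i j
      simp [evMat, coords, P, y, ca, Matrix.vandermonde_apply, ← Finset.prod_pow, ← pow_mul,
        mul_comm]
    have hdet : ((evMat (coords K P) d).submatrix ca em).det ≠ 0 := by
      rw [hsub, Matrix.det_transpose, Matrix.det_vandermonde_ne_zero_iff]
      intro i j h
      exact em.injective (hy (Nat.cast_injective h))
    have h1 := Matrix.rank_of_det_ne_zero hdet
    rw [Fintype.card_fin] at h1
    rw [← h1]
    exact Matrix.rank_submatrix_le _ _ _

theorem generic_position_open (K : Type) [Field K] [IsAlgClosed K] [CharZero K]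
    (k : ℕ) (hk : 0 < k) (n : Fin k → ℕ) (hn : ∀ i, 1 ≤ n i) (s : ℕ) :
    ∃ S : Set (MvPolynomial (Fin s × Var k n) K),
      -- within the locus of tuples of valid representatives of `s` distinct points,
      -- generic position is the (Zariski-open) non-vanishing locus of the family `S`
      (∀ P : Fin s → PointRep K k n, SPoints K P →
        (GenericPosition K P ↔
          ∃ f ∈ S, eval (fun p : Fin s × Var k n => P p.1 p.2.1 p.2.2) f ≠ 0)) ∧
      -- and it is non-empty
      ∃ P : Fin s → PointRep K k n, GenericPosition K P := by
  classical
  refine ⟨{f | ∃ (B : ∀ d, Matrix (Fin (min (NN k n d) s)) (Fin s) K)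
      (C : ∀ d, Matrix (Mon k n d) (Fin (min (NN k n d) s)) K),
      f = ∏ d ∈ box k s, detPoly K n s d (B d) (C d)}, ?_, exists_generic K k hk n hn s⟩
  intro P hP
  have hcase : ∀ d, (evMat (coords K P) d).rank = min (NN k n d) s ↔
      min (NN k n d) s ≤ (evMat (coords K P) d).rank :=
    fun d => ⟨fun h => h.ge, fun h => le_antisymm (rank_le K _ d) h⟩
  have hev : ∀ d B C, eval (fun p : Fin s × Var k n => P p.1 p.2.1 p.2.2) (detPoly K n s d B C) =
      (B * evMat (coords K P) d * C).det := fun d B C => eval_detPoly K n s d B C (coords K P)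
  constructor
  · rintro ⟨-, h⟩
    have h' : ∀ d, ∃ (B : Matrix (Fin (min (NN k n d) s)) (Fin s) K)
        (C : Matrix (Mon k n d) (Fin (min (NN k n d) s)) K),
        (B * evMat (coords K P) d * C).det ≠ 0 := by
      intro d
      rw [← exists_det_ne_zero, ← hcase, ← hilbert_eq_rank]
      exact h d
    choose B C hBC using h'
    refine ⟨_, ⟨B, C, rfl⟩, ?_⟩
    rw [map_prod]
    refine Finset.prod_ne_zero_iff.2 fun d _ => ?_
    rw [hev]
    exact hBC d
  · rintro ⟨_, ⟨B, C, rfl⟩, h⟩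
    rw [map_prod, Finset.prod_ne_zero_iff] at h
    refine ⟨hP, fun d => ?_⟩
    rw [hilbert_eq_rank]
    refine all_of_box K hn P hP.1 (fun d hd => ?_) d
    rw [hcase, exists_det_ne_zero]
    refine ⟨B d, C d, ?_⟩
    rw [← hev]
    exact h d hd

end MultiProjPoints
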